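/- arXiv:0810.1382 — 2 statements merged into one kernel-verified Lean document; each statement's English description precedes it below -/
import Mathlib

section
/- Let f₂ = y² + (x+1)y + x² ∈ ℂ[x,y], let φ(u) = −u² + u³ − 2u⁴ + 4u⁵ − 9u⁶ + (111/4)u⁷ − (183/2)u⁸ + 316u⁹ − 1079u¹⁰ + (7259/2)u¹¹ − (801559/64)u¹² + (2872109/64)u¹³ − (5348333/32)u¹⁴, and let J₆ = (u⁶, u²v, v²) ⊆ ℂ[u,v]. Then the set of polynomials g ∈ ℂ[x,y] of total degree ≤ 3 such that g(u, v + φ(u)) ∈ J₆ is exactly the two-dimensional ℂ-linear span of y·f₂ and y³. -/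
open MvPolynomial

noncomputable def u : MvPolynomial (Fin 2) ℂ := MvPolynomial.X 0
noncomputable def v : MvPolynomial (Fin 2) ℂ := MvPolynomial.X 1

/-- The conic `f₂ = y² + (x+1)y + x²` (in the variables `x = X 0`, `y = X 1`). -/
noncomputable def f₂ : MvPolynomial (Fin 2) ℂ := v ^ 2 + (u + 1) * v + u ^ 2

/-- The coordinate-change polynomial `φ(u)` of Remark 2. -/
noncomputable def phi : MvPolynomial (Fin 2) ℂ :=
  -u ^ 2 + u ^ 3 - 2 * u ^ 4 + 4 * u ^ 5 - 9 * u ^ 6 + C (111 / 4) * u ^ 7 -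
    C (183 / 2) * u ^ 8 + 316 * u ^ 9 - 1079 * u ^ 10 + C (7259 / 2) * u ^ 11 -
    C (801559 / 64) * u ^ 12 + C (2872109 / 64) * u ^ 13 - C (5348333 / 32) * u ^ 14

/-- The localization map `σ(g)(u,v) = g(u, v + φ(u))`. -/
noncomputable def σ (g : MvPolynomial (Fin 2) ℂ) : MvPolynomial (Fin 2) ℂ :=
  MvPolynomial.aeval ![u, v + phi] g

/-- The adjunction ideal `J_{O,6,10} = (u⁶, u²v, v²)`. -/
noncomputable def J₆ : Ideal (MvPolynomial (Fin 2) ℂ) :=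
  Ideal.span {u ^ 6, u ^ 2 * v, v ^ 2}

/-- The exponent vector of the monomial `uⁱ vʲ`. -/
noncomputable def expo (i j : ℕ) : Fin 2 →₀ ℕ := Finsupp.single 0 i + Finsupp.single 1 j

theorem expo_inj {i j k l : ℕ} : expo i j = expo k l ↔ i = k ∧ j = l := by
  constructor
  · intro h
    have h0 := DFunLike.congr_fun h 0
    have h1 := DFunLike.congr_fun h 1
    simp [expo] at h0 h1
    exact ⟨h0, h1⟩
  · rintro ⟨rfl, rfl⟩; rfl

theorem expo_le {i j k l : ℕ} : expo i j ≤ expo k l ↔ i ≤ k ∧ j ≤ l := by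
  rw [Finsupp.le_def, Fin.forall_fin_two]
  simp [expo]

theorem eq_expo (m : Fin 2 →₀ ℕ) : m = expo (m 0) (m 1) := by
  ext i
  fin_cases i <;> simp [expo]

theorem monomial_expo (i j : ℕ) (a : ℂ) : monomial (expo i j) a = C a * (u ^ i * v ^ j) := by
  rw [expo, u, v, X_pow_eq_monomial, X_pow_eq_monomial, monomial_mul, C_mul_monomial]
  simp

theorem totalDegree_monomial_expo_le {i j n : ℕ} (h : i + j ≤ n) (a : ℂ) :
    (monomial (expo i j) a).totalDegree ≤ n := by
  refine (totalDegree_monomial_le _ _).trans ?_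
  rw [Finsupp.sum_fintype _ _ (by simp)]
  simpa [expo, Fin.sum_univ_two] using h

theorem eq_cubic_of_totalDegree_le {g : MvPolynomial (Fin 2) ℂ} (hg : g.totalDegree ≤ 3) :
    g = monomial (expo 0 0) (coeff (expo 0 0) g) + monomial (expo 1 0) (coeff (expo 1 0) g) +
      monomial (expo 2 0) (coeff (expo 2 0) g) + monomial (expo 3 0) (coeff (expo 3 0) g) +
      monomial (expo 0 1) (coeff (expo 0 1) g) + monomial (expo 1 1) (coeff (expo 1 1) g) +
      monomial (expo 2 1) (coeff (expo 2 1) g) + monomial (expo 0 2) (coeff (expo 0 2) g) +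
      monomial (expo 1 2) (coeff (expo 1 2) g) + monomial (expo 0 3) (coeff (expo 0 3) g) := by
  ext m
  obtain ⟨i, j, rfl⟩ : ∃ i j, m = expo i j := ⟨_, _, eq_expo m⟩
  simp only [coeff_add, coeff_monomial, expo_inj]
  by_cases h : i + j ≤ 3
  · have hi : i ≤ 3 := by omega
    have hj : j ≤ 3 := by omega
    interval_cases i <;> interval_cases j <;> first | omega | simp
  · have h0 : coeff (expo i j) g = 0 := by
      apply coeff_eq_zero_of_totalDegree_lt
      refine hg.trans_lt ?_
      rw [← Finsupp.degree_apply]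
      simp [expo]
      omega
    rw [h0]
    repeat rw [if_neg (by omega)]
    simp

theorem J₆_eq : J₆ = Ideal.span
    ((fun m ↦ monomial m (1 : ℂ)) '' {expo 6 0, expo 2 1, expo 0 2}) := by
  simp [J₆, Set.image_insert_eq, monomial_expo]

theorem coeff_eq_zero_of_mem_J₆ {p : MvPolynomial (Fin 2) ℂ} (hp : p ∈ J₆) {i j : ℕ}
    (h : j = 0 ∧ i < 6 ∨ j = 1 ∧ i < 2) : coeff (expo i j) p = 0 := by
  rw [J₆_eq, mem_ideal_span_monomial_image] at hp
  by_contra hc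
  obtain ⟨s, hs, hle⟩ := hp _ (mem_support_iff.mpr hc)
  rcases hs with rfl | rfl | rfl <;> rw [expo_le] at hle <;> omega

theorem exists_phi_eq : ∃ r : MvPolynomial (Fin 2) ℂ,
    phi = -u ^ 2 + u ^ 3 - 2 * u ^ 4 + 4 * u ^ 5 + u ^ 6 * r :=
  ⟨-9 + C (111 / 4) * u - C (183 / 2) * u ^ 2 + 316 * u ^ 3 - 1079 * u ^ 4 +
    C (7259 / 2) * u ^ 5 - C (801559 / 64) * u ^ 6 + C (2872109 / 64) * u ^ 7 -
    C (5348333 / 32) * u ^ 8, by rw [phi]; ring⟩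

/-- A representative, modulo `J₆`, of the image under `σ` of the cubic with coefficients
`a i j` at `xⁱ yʲ`. -/
theorem σ_cubic_sub_mem (a₀₀ a₁₀ a₂₀ a₃₀ a₀₁ a₁₁ a₂₁ a₀₂ a₁₂ a₀₃ : ℂ) :
    σ (monomial (expo 0 0) a₀₀ + monomial (expo 1 0) a₁₀ + monomial (expo 2 0) a₂₀ +
      monomial (expo 3 0) a₃₀ + monomial (expo 0 1) a₀₁ + monomial (expo 1 1) a₁₁ +
      monomial (expo 2 1) a₂₁ + monomial (expo 0 2) a₀₂ + monomial (expo 1 2) a₁₂ +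
      monomial (expo 0 3) a₀₃) -
    (monomial (expo 0 0) a₀₀ + monomial (expo 1 0) a₁₀ + monomial (expo 2 0) (a₂₀ - a₀₁) +
      monomial (expo 3 0) (a₃₀ + a₀₁ - a₁₁) +
      monomial (expo 4 0) (-2 * a₀₁ + a₁₁ - a₂₁ + a₀₂) +
      monomial (expo 5 0) (4 * a₀₁ - 2 * a₁₁ + a₂₁ - 2 * a₀₂ + a₁₂) +
      monomial (expo 0 1) a₀₁ + monomial (expo 1 1) a₁₁) ∈ J₆ := by
  obtain ⟨r, hr⟩ := exists_phi_eq
  have hu : σ u = u := by simp [σ, u]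
  have hv : σ v = v + phi := by simp [σ, v]
  have hC (c : ℂ) : σ (C c) = C c := by simp [σ, algebraMap_eq]
  have hadd (p q) : σ (p + q) = σ p + σ q := map_add _ p q
  have hmul (p q) : σ (p * q) = σ p * σ q := map_mul _ p q
  have hpow (p) (n : ℕ) : σ (p ^ n) = σ p ^ n := map_pow _ p n
  simp only [monomial_expo, hadd, hmul, hpow, hu, hv, hC, map_add, map_sub, map_mul, map_neg,
    map_ofNat]
  have h₁ : u ^ 6 ∈ J₆ := Ideal.subset_span (by simp)
  have h₂ : u ^ 2 * v ∈ J₆ := Ideal.subset_span (by simp)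
  have h₃ : v ^ 2 ∈ J₆ := Ideal.subset_span (by simp)
  rw [hr, ← Ideal.Quotient.eq_zero_iff_mem]
  rw [← Ideal.Quotient.eq_zero_iff_mem] at h₁ h₂ h₃
  simp only [map_add, map_sub, map_mul, map_neg, map_pow, map_ofNat] at h₁ h₂ h₃ ⊢
  generalize Ideal.Quotient.mk J₆ u = U at *
  generalize Ideal.Quotient.mk J₆ v = V at *
  generalize Ideal.Quotient.mk J₆ r = R
  have e₁ : U ^ 2 * (V + (-U ^ 2 + U ^ 3 - 2 * U ^ 4 + 4 * U ^ 5 + U ^ 6 * R)) =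
      -U ^ 4 + U ^ 5 := by
    linear_combination h₂ + (-2 + 4 * U + U ^ 2 * R) * h₁
  have e₂ : (V + (-U ^ 2 + U ^ 3 - 2 * U ^ 4 + 4 * U ^ 5 + U ^ 6 * R)) ^ 2 =
      U ^ 4 - 2 * U ^ 5 := by
    linear_combination h₃ + 2 * (-1 + U - 2 * U ^ 2 + 4 * U ^ 3 + U ^ 4 * R) * h₂ +
      (1 + 2 * (-2 + 4 * U + U ^ 2 * R) * (U - 1) + U ^ 2 * (-2 + 4 * U + U ^ 2 * R) ^ 2) * h₁
  have e₃ : (V + (-U ^ 2 + U ^ 3 - 2 * U ^ 4 + 4 * U ^ 5 + U ^ 6 * R)) ^ 3 = 0 := by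
    rw [pow_succ, e₂]
    linear_combination (U ^ 2 - 2 * U ^ 3) * e₁ + (-1 + 3 * U - 2 * U ^ 2) * h₁
  set A := fun c : ℂ ↦ Ideal.Quotient.mk J₆ (C c)
  linear_combination (A a₀₁ * R + A a₁₁ * (4 + U * R) - 2 * A a₁₂) * h₁ + A a₂₁ * e₁ +
    (A a₀₂ + A a₁₂ * U) * e₂ + A a₀₃ * e₃

theorem f₂_combination_eq (a b : ℂ) : a • (v * f₂) + b • v ^ 3 =
    monomial (expo 0 0) 0 + monomial (expo 1 0) 0 + monomial (expo 2 0) 0 +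
      monomial (expo 3 0) 0 + monomial (expo 0 1) 0 + monomial (expo 1 1) 0 +
      monomial (expo 2 1) a + monomial (expo 0 2) a + monomial (expo 1 2) a +
      monomial (expo 0 3) (a + b) := by
  simp only [monomial_expo, smul_eq_C_mul, f₂, map_add, map_zero]
  ring

theorem linearIndependent_mul_f₂_pow : LinearIndependent ℂ ![v * f₂, v ^ 3] := by
  rw [LinearIndependent.pair_iff]
  intro a b h
  rw [f₂_combination_eq] at h
  have h₁ := congrArg (coeff (expo 2 1)) h
  have h₂ := congrArg (coeff (expo 0 3)) h
  simp [coeff_monomial, expo_inj] at h₁ h₂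
  simp_all

/-- Case `k = 6` of Assertion 3(b): `Ker σ̄₆` is the two-dimensional span of
`y f₂` and `y³`. -/
theorem ker_sigma_six :
    {g : MvPolynomial (Fin 2) ℂ | g.totalDegree ≤ 3 ∧ σ g ∈ J₆} =
      ↑(Submodule.span ℂ {v * f₂, v ^ 3}) ∧
    Module.finrank ℂ ↥(Submodule.span ℂ ({v * f₂, v ^ 3} :
      Set (MvPolynomial (Fin 2) ℂ))) = 2 := by
  refine ⟨?_, ?_⟩
  · ext g
    rw [Set.mem_ofPred_eq, SetLike.mem_coe, Submodule.mem_span_pair]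
    constructor
    · rintro ⟨hd, hσ⟩
      have hg := eq_cubic_of_totalDegree_le hd
      generalize coeff (expo 0 0) g = a₀₀, coeff (expo 1 0) g = a₁₀, coeff (expo 2 0) g = a₂₀,
        coeff (expo 3 0) g = a₃₀, coeff (expo 0 1) g = a₀₁, coeff (expo 1 1) g = a₁₁,
        coeff (expo 2 1) g = a₂₁, coeff (expo 0 2) g = a₀₂, coeff (expo 1 2) g = a₁₂,
        coeff (expo 0 3) g = a₀₃ at hg
      subst hg
      have hmem := (Submodule.sub_mem_iff_right _ hσ).mp
        (σ_cubic_sub_mem a₀₀ a₁₀ a₂₀ a₃₀ a₀₁ a₁₁ a₂₁ a₀₂ a₁₂ a₀₃)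
      have c₀₀ := coeff_eq_zero_of_mem_J₆ hmem (i := 0) (j := 0) (by simp)
      have c₁₀ := coeff_eq_zero_of_mem_J₆ hmem (i := 1) (j := 0) (by simp)
      have c₂₀ := coeff_eq_zero_of_mem_J₆ hmem (i := 2) (j := 0) (by simp)
      have c₃₀ := coeff_eq_zero_of_mem_J₆ hmem (i := 3) (j := 0) (by simp)
      have c₄₀ := coeff_eq_zero_of_mem_J₆ hmem (i := 4) (j := 0) (by simp)
      have c₅₀ := coeff_eq_zero_of_mem_J₆ hmem (i := 5) (j := 0) (by simp)
      have c₀₁ := coeff_eq_zero_of_mem_J₆ hmem (i := 0) (j := 1) (by simp)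
      have c₁₁ := coeff_eq_zero_of_mem_J₆ hmem (i := 1) (j := 1) (by simp)
      simp [coeff_monomial, expo_inj] at c₀₀ c₁₀ c₂₀ c₃₀ c₄₀ c₅₀ c₀₁ c₁₁
      subst c₀₀ c₁₀ c₀₁ c₁₁
      obtain rfl : a₂₀ = 0 := by linear_combination c₂₀
      obtain rfl : a₃₀ = 0 := by linear_combination c₃₀
      obtain rfl : a₀₂ = a₂₁ := by linear_combination c₄₀
      obtain rfl : a₁₂ = a₀₂ := by linear_combination c₅₀
      exact ⟨a₁₂, a₀₃ - a₁₂, by rw [f₂_combination_eq, add_sub_cancel]⟩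
    · rintro ⟨a, b, rfl⟩
      rw [f₂_combination_eq]
      constructor
      · simp only [← mem_restrictTotalDegree]
        repeat' apply Submodule.add_mem
        all_goals
          rw [mem_restrictTotalDegree]
          exact totalDegree_monomial_expo_le (by norm_num) _
      · have h := σ_cubic_sub_mem 0 0 0 0 0 0 a a a (a + b)
        have e₄ : -2 * 0 + 0 - a + a = 0 := by ring
        have e₅ : 4 * 0 - 2 * 0 + a - 2 * a + a = 0 := by ring
        rw [e₄, e₅] at h
        simpa using h
  · have h := finrank_span_eq_card linearIndependent_mul_f₂_pow
    rwa [Matrix.range_cons_cons_empty, Fintype.card_fin] at h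
end

section
/- Let f₂ = y² + (x+1)y + x² ∈ ℂ[x,y], let φ(u) = −u² + u³ − 2u⁴ + 4u⁵ − 9u⁶ + (111/4)u⁷ − (183/2)u⁸ + 316u⁹ − 1079u¹⁰ + (7259/2)u¹¹ − (801559/64)u¹² + (2872109/64)u¹³ − (5348333/32)u¹⁴, let h₁ = v + (4/9)u², and let J₈ = (u¹³, u⁵v, u³v², uv³, v⁴, u²v·h₁, v²·h₁) ⊆ ℂ[u,v]. Then the set of polynomials g ∈ ℂ[x,y] of total degree ≤ 5 such that g(u, v + φ(u)) ∈ J₈ is exactly the one-dimensional space ℂ·y³f₂. -/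
open MvPolynomial

/-- `h₁ = v + (4/9)u²`. -/
noncomputable def h₁ : MvPolynomial (Fin 2) ℂ := v + C (4 / 9) * u ^ 2

/-- The adjunction ideal `J_{O,8,10} = (u¹³, u⁵v, u³v², uv³, v⁴, u²v·h₁, v²·h₁)`. -/
noncomputable def J₈ : Ideal (MvPolynomial (Fin 2) ℂ) :=
  Ideal.span {u ^ 13, u ^ 5 * v, u ^ 3 * v ^ 2, u * v ^ 3, v ^ 4,
    u ^ 2 * v * h₁, v ^ 2 * h₁}

open Polynomial in
/-- The ring homomorphism `ℂ[u,v] → ℂ[t]` restricting to the parabola `v = c u²`. -/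
noncomputable def parabolaHom (c : ℂ) : MvPolynomial (Fin 2) ℂ →ₐ[ℂ] ℂ[X] :=
  MvPolynomial.aeval ![Polynomial.X, Polynomial.C c * Polynomial.X ^ 2]

@[simp] lemma parabolaHom_u (c : ℂ) : parabolaHom c u = Polynomial.X := by
  simp [parabolaHom, u]

@[simp] lemma parabolaHom_v (c : ℂ) :
    parabolaHom c v = Polynomial.C c * Polynomial.X ^ 2 := by
  simp [parabolaHom, v]

@[simp] lemma parabolaHom_C (c a : ℂ) : parabolaHom c (C a) = Polynomial.C a := by
  simp [parabolaHom, Polynomial.algebraMap_eq]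

/-- Elements of `J₈` vanish to order `n` along the parabola `v = c u²`, where `n = 13` if `c = 0`,
`n = 7` if `c = -4/9`, and `n = 6` otherwise. -/
lemma X_pow_dvd_parabolaHom {c : ℂ} {n : ℕ} (h13 : n ≤ 13) (h7 : c = 0 ∨ n ≤ 7)
    (h6 : c = 0 ∨ c = -4 / 9 ∨ n ≤ 6) {p : MvPolynomial (Fin 2) ℂ} (hp : p ∈ J₈) :
    Polynomial.X ^ n ∣ parabolaHom c p := by
  have key : ∀ (q : MvPolynomial (Fin 2) ℂ) (a : ℂ) (k : ℕ),
      parabolaHom c q = Polynomial.C a * Polynomial.X ^ k → (a = 0 ∨ n ≤ k) →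
      Polynomial.X ^ n ∣ parabolaHom c q := by
    rintro q a k hq (rfl | hk)
    · simp [hq]
    · exact hq ▸ (pow_dvd_pow _ hk).mul_left _
  suffices h : J₈ ≤ (Ideal.span {Polynomial.X ^ n}).comap (parabolaHom c) from
    Ideal.mem_span_singleton.1 (h hp)
  refine Ideal.span_le.2 fun q hq => Ideal.mem_span_singleton.2 ?_
  have h6' : c = 0 ∨ c + 4 / 9 = 0 ∨ n ≤ 6 := by
    refine h6.imp_right (Or.imp_left fun h => ?_)
    rw [h]; norm_num
  rcases hq with rfl | rfl | rfl | rfl | rfl | rfl | rfl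
  · exact key _ 1 13 (by simp) (Or.inr h13)
  · exact key _ c 7 (by simp; ring) h7
  · exact key _ (c ^ 2) 7 (by simp; ring) (h7.imp_left (by simp [·]))
  · exact key _ (c ^ 3) 7 (by simp; ring) (h7.imp_left (by simp [·]))
  · exact key _ (c ^ 4) 8 (by simp; ring) (h7.imp (by simp [·]) (by lia))
  · refine key _ (c * (c + 4 / 9)) 6 (by simp [h₁]; ring) ?_
    rw [mul_eq_zero, or_assoc]; exact h6'
  · refine key _ (c ^ 2 * (c + 4 / 9)) 6 (by simp [h₁]; ring) ?_
    rw [mul_eq_zero, or_assoc]; exact h6'.imp_left (by simp [·])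

/-- A bivariate polynomial of total degree at most `n` is a sum of the `u ^ i * v ^ j` with
`i + j ≤ n`. -/
lemma eq_sum_of_totalDegree_le {n : ℕ} {g : MvPolynomial (Fin 2) ℂ} (hg : g.totalDegree ≤ n) :
    ∃ a : ℕ → ℕ → ℂ, g = ∑ i ∈ Finset.range (n + 1), ∑ j ∈ Finset.range (n + 1 - i),
      C (a i j) * u ^ i * v ^ j := by
  let e : ℕ × ℕ → Fin 2 →₀ ℕ := fun p => Finsupp.single 0 p.1 + Finsupp.single 1 p.2
  have he : ∀ s : Fin 2 →₀ ℕ, e (s 0, s 1) = s := fun s => by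
    ext k; fin_cases k <;> simp [e]
  have he' : Function.Injective e := fun p q h => by
    have h0 := DFunLike.congr_fun h 0
    have h1 := DFunLike.congr_fun h 1
    simp [e] at h0 h1
    exact Prod.ext h0 h1
  refine ⟨fun i j => g.coeff (e (i, j)), ?_⟩
  rw [Finset.sum_sigma']
  refine Eq.trans ?_ (Finset.sum_map (Finset.sigma _ _) (Equiv.sigmaEquivProd ℕ ℕ).toEmbedding
    fun p => C (g.coeff (e p)) * u ^ p.1 * v ^ p.2)
  conv_lhs => rw [g.as_sum]
  have hm : ∀ p, monomial (e p) (g.coeff (e p)) = C (g.coeff (e p)) * u ^ p.1 * v ^ p.2 :=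
    fun p => by
      rw [u, v, mul_assoc, X_pow_eq_monomial, X_pow_eq_monomial, monomial_mul, C_mul_monomial]
      simp [e]
  simp_rw [← hm]
  refine Eq.trans ?_ (Finset.sum_map _ ⟨e, he'⟩ fun s => monomial s (g.coeff s))
  refine Finset.sum_subset (fun s hs => ?_) fun s _ hs => by simp [notMem_support_iff.1 hs]
  have hdeg := (le_totalDegree hs).trans hg
  rw [Finsupp.sum_fintype _ _ (fun _ => rfl), Fin.sum_univ_two] at hdeg
  refine Finset.mem_map.2 ⟨(s 0, s 1), Finset.mem_map.2 ⟨⟨s 0, s 1⟩, ?_, rfl⟩, he s⟩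
  simp only [Finset.mem_sigma, Finset.mem_range]
  lia

/-- Along `v = φ(u)` the conic `f₂` vanishes to order `7`. -/
lemma u_pow_seven_dvd : u ^ 7 ∣ phi ^ 2 + (u + 1) * phi + u ^ 2 := by
  refine ⟨C (27/4) - C (135/4) * u + C (135) * u ^ 2 - C (945/2) * u ^ 3 + C (3105/2) * u ^ 4 - C
      (347895/64) * u ^ 5 + C (654075/32) * u ^ 6 - C (5164155/64) * u ^ 7 - C (10107321/32) * u
      ^ 8 + C (17551677/32) * u ^ 9 - C (797016) * u ^ 10 + C (56055807/32) * u ^ 11 - C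
      (535819821/128) * u ^ 12 + C (1439889549/128) * u ^ 13 - C (1063561851/32) * u ^ 14 + C
      (198297387/2) * u ^ 15 - C (18776820915/64) * u ^ 16 + C (3454147675857/4096) * u ^ 17 - C
      (4786871969739/2048) * u ^ 18 + C (25397027912469/4096) * u ^ 19 - C (15360995344297/1024)
      * u ^ 20 + C (28604665878889/1024) * u ^ 21, ?_⟩
  refine MvPolynomial.funext fun x => ?_
  simp only [phi, u, map_add, map_sub, map_neg, map_mul, map_pow, map_one, map_ofNat, eval_X,
    eval_C]
  ring

lemma u_sq_dvd_phi : u ^ 2 ∣ phi := by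
  refine ⟨-1 + u - C (2) * u ^ 2 + C (4) * u ^ 3 - C (9) * u ^ 4 + C (111/4) * u ^ 5 - C (183/2) * u
      ^ 6 + C (316) * u ^ 7 - C (1079) * u ^ 8 + C (7259/2) * u ^ 9 - C (801559/64) * u ^ 10 + C
      (2872109/64) * u ^ 11 - C (5348333/32) * u ^ 12, ?_⟩
  refine MvPolynomial.funext fun x => ?_
  simp only [phi, u, map_add, map_sub, map_neg, map_mul, map_pow, map_one, map_ofNat, eval_X,
    eval_C]
  ring

lemma sigma_v_cubed_mul_conic_mem : σ (v ^ 3 * f₂) ∈ J₈ := by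
  obtain ⟨b, hb⟩ := u_pow_seven_dvd
  obtain ⟨a, ha⟩ := u_sq_dvd_phi
  have hσ : σ (v ^ 3 * f₂) = (v + phi) ^ 3 * (v * (v + 2 * phi + u + 1) + u ^ 7 * b) := by
    rw [← hb]
    simp only [σ, f₂, u, v, map_add, map_mul, map_pow, map_one, aeval_X, Matrix.cons_val_zero,
      Matrix.cons_val_one]
    ring
  have m1 : u ^ 13 ∈ J₈ := Ideal.subset_span (by simp)
  have m2 : u ^ 5 * v ∈ J₈ := Ideal.subset_span (by simp)
  have m3 : u ^ 3 * v ^ 2 ∈ J₈ := Ideal.subset_span (by simp)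
  have m4 : u * v ^ 3 ∈ J₈ := Ideal.subset_span (by simp)
  have m5 : v ^ 4 ∈ J₈ := Ideal.subset_span (by simp)
  set k := v + 2 * phi + u + 1
  have : σ (v ^ 3 * f₂) = a ^ 3 * b * u ^ 13 + (u * a ^ 3 * k + 3 * a ^ 2 * b * u ^ 6) * (u ^ 5 * v)
      + (3 * a ^ 2 * k * u + 3 * a * b * u ^ 6) * (u ^ 3 * v ^ 2)
      + (3 * a * k * u + b * u ^ 6) * (u * v ^ 3) + k * v ^ 4 := by
    rw [hσ, ha]; ring
  rw [this]
  exact add_mem (add_mem (add_mem (add_mem (J₈.mul_mem_left _ m1) (J₈.mul_mem_left _ m2))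
    (J₈.mul_mem_left _ m3)) (J₈.mul_mem_left _ m4)) (J₈.mul_mem_left _ m5)

lemma totalDegree_v_cubed_mul_conic_le : (v ^ 3 * f₂).totalDegree ≤ 5 := by
  have hu : u.totalDegree = 1 := totalDegree_X 0
  have hv : v.totalDegree = 1 := totalDegree_X 1
  have h2 (p : MvPolynomial (Fin 2) ℂ) (hp : p.totalDegree = 1) : (p ^ 2).totalDegree ≤ 2 := by
    simpa [hp] using totalDegree_pow p 2
  have h3 : (v ^ 3).totalDegree ≤ 3 := by simpa [hv] using totalDegree_pow v 3
  have hu1 : (u + 1).totalDegree ≤ 1 := by simpa [hu] using totalDegree_add u 1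
  have hf : f₂.totalDegree ≤ 2 := by
    refine (totalDegree_add _ _).trans (max_le ((totalDegree_add _ _).trans (max_le (h2 v hv) ?_))
      (h2 u hu))
    exact (totalDegree_mul _ _).trans (by lia)
  exact (totalDegree_mul _ _).trans (by lia)

namespace Polynomial

/-- The restriction of `y = v + φ(u)` to the parabola `v = c u²`. -/
noncomputable def parabolaY (c : ℂ) : ℂ[X] := parabolaHom c (v + phi)

lemma parabolaY_eval (c t : ℂ) : (parabolaY c).eval t = c * t ^ 2
      + (-t ^ 2 + t ^ 3 - (2) * t ^ 4 + (4) * t ^ 5 - (9) * t ^ 6 + (111/4) * t ^ 7 - (183/2) *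
      t ^ 8 + (316) * t ^ 9 - (1079) * t ^ 10 + (7259/2) * t ^ 11 - (801559/64) * t ^ 12 +
      (2872109/64) * t ^ 13 - (5348333/32) * t ^ 14) := by
  simp only [parabolaY, phi, map_add, map_sub, map_neg, map_mul, map_pow, map_ofNat, parabolaHom_u,
    parabolaHom_v, parabolaHom_C, eval_add, eval_sub, eval_neg, eval_mul, eval_pow, eval_X, eval_C,
    eval_ofNat]

/-- Coefficient form of the vanishing of `g(x, y)` along a truncated branch. -/
lemma sum_coeff_eq_zero {c : ℂ} {n : ℕ} (h13 : n ≤ 13) (h7 : c = 0 ∨ n ≤ 7)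
    (h6 : c = 0 ∨ c = -4 / 9 ∨ n ≤ 6) {N : ℕ} {a : ℕ → ℕ → ℂ} {g : MvPolynomial (Fin 2) ℂ}
    (hg : g = ∑ i ∈ Finset.range N, ∑ j ∈ Finset.range (N - i), MvPolynomial.C (a i j) * u ^ i * v ^ j)
    (hσ : σ g ∈ J₈) {P : ℕ → ℂ[X]} (h0 : P 0 = 1)
    (hP : ∀ j, j + 1 < N → X ^ n ∣ parabolaY c * P j - P (j + 1)) {d : ℕ} (hd : d < n) :
    ∑ i ∈ Finset.range N, ∑ j ∈ Finset.range (N - i), a i j * (X ^ i * P j).coeff d = 0 := by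
  have hpow : ∀ j, j < N → X ^ n ∣ parabolaY c ^ j - P j := by
    intro j
    induction j with
    | zero => simp [h0]
    | succ j ih =>
      intro hj
      convert ((ih (by lia)).mul_left (parabolaY c)).add (hP j hj) using 1
      ring
  have hmap : parabolaHom c (σ g) = ∑ i ∈ Finset.range N, ∑ j ∈ Finset.range (N - i),
      C (a i j) * X ^ i * parabolaY c ^ j := by
    have hu : σ u = u := by simp [σ, u]
    have hv : σ v = v + phi := by simp [σ, v]
    have hC : ∀ z, σ (MvPolynomial.C z) = MvPolynomial.C z := fun z => by simp [σ, MvPolynomial.algebraMap_eq]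
    simp only [σ] at hu hv hC ⊢
    simp only [hg, map_sum, map_mul, map_pow, hu, hv, hC, parabolaHom_u, parabolaHom_C, parabolaY]
  have hdvd : X ^ n ∣ ∑ i ∈ Finset.range N, ∑ j ∈ Finset.range (N - i),
      C (a i j) * (X ^ i * P j) := by
    have h1 := X_pow_dvd_parabolaHom h13 h7 h6 hσ
    rw [hmap] at h1
    rw [← dvd_sub_right h1, ← Finset.sum_sub_distrib]
    refine Finset.dvd_sum fun i _ => ?_
    rw [← Finset.sum_sub_distrib]
    refine Finset.dvd_sum fun j hj => ?_
    convert (hpow j (by have := Finset.mem_range.1 hj; lia)).mul_left (C (a i j) * X ^ i) using 1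
    ring
  simpa [finsetSum_coeff] using X_pow_dvd_iff.1 hdvd d hd

/-- `y ^ j` modulo `t ^ 13` on the line `v = 0`. -/
noncomputable def branchPow : ℕ → ℂ[X]
  | 0 => 1
  | 1 =>
    -X ^ 2 + X ^ 3 - C (2) * X ^ 4 + C (4) * X ^ 5 - C (9) * X ^ 6 + C (111/4) * X ^ 7 - C
    (183/2) * X ^ 8 + C (316) * X ^ 9 - C (1079) * X ^ 10 + C (7259/2) * X ^ 11 - C (801559/64)
    * X ^ 12
  | 2 =>
    X ^ 4 - C (2) * X ^ 5 + C (5) * X ^ 6 - C (12) * X ^ 7 + C (30) * X ^ 8 - C (179/2) * X ^ 9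
    + C (581/2) * X ^ 10 - C (998) * X ^ 11 + C (3459) * X ^ 12
  | 3 =>
    -X ^ 6 + C (3) * X ^ 7 - C (9) * X ^ 8 + C (25) * X ^ 9 - C (69) * X ^ 10 + C (837/4) * X ^
    11 - C (680) * X ^ 12
  | 4 =>
    X ^ 8 - C (4) * X ^ 9 + C (14) * X ^ 10 - C (44) * X ^ 11 + C (133) * X ^ 12
  | 5 =>
    -X ^ 10 + C (5) * X ^ 11 - C (20) * X ^ 12
  | _ => 0

set_option linter.unusedSimpArgs false in
lemma branchPow_succ (j : ℕ) (hj : j + 1 < 6) :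
    X ^ 13 ∣ parabolaY (0) * branchPow j - branchPow (j + 1) := by
  have : j < 5 := by lia
  interval_cases j
  · refine ⟨C (2872109/64) - C (5348333/32) * X, Polynomial.funext fun t => ?_⟩
    simp only [branchPow, parabolaY_eval, eval_add, eval_sub, eval_neg, eval_mul, eval_pow, eval_X, eval_C, eval_one,
      eval_zero]
    ring
  · refine ⟨-C (23825/2) + C (1330201/32) * X - C (6645867/64) * X ^ 2 + C (21534579/64) * X ^ 3 - C
      (8642035/16) * X ^ 4 + C (39614923/32) * X ^ 5 - C (398548531/128) * X ^ 6 + C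
      (2175895023/256) * X ^ 7 - C (1567493247/64) * X ^ 8 + C (4459185001/64) * X ^ 9 - C
      (768604303/4) * X ^ 10 + C (2048322253169/4096) * X ^ 11 - C (4786871969739/4096) * X ^ 12
      + C (4287004451147/2048) * X ^ 13, Polynomial.funext fun t => ?_⟩
    simp only [branchPow, parabolaY_eval, eval_add, eval_sub, eval_neg, eval_mul, eval_pow, eval_X, eval_C, eval_one,
      eval_zero]
    ring
  · refine ⟨C (9333/4) - C (16335/2) * X + C (33441/2) * X ^ 2 - C (3054303/64) * X ^ 3 + C
      (9572451/64) * X ^ 4 - C (32583863/64) * X ^ 5 + C (76384281/64) * X ^ 6 - C (6040169/2) *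
      X ^ 7 + C (985230321/128) * X ^ 8 - C (1281494753/64) * X ^ 9 + C (6790278691/128) * X ^
      10 - C (2186584709/16) * X ^ 11 + C (20609897699/64) * X ^ 12 - C (18499883847/32) * X ^
      13, Polynomial.funext fun t => ?_⟩
    simp only [branchPow, parabolaY_eval, eval_add, eval_sub, eval_neg, eval_mul, eval_pow, eval_X, eval_C, eval_one,
      eval_zero]
    ring
  · refine ⟨-C (419) + C (1383) * X - C (9759/4) * X ^ 2 + C (25449/4) * X ^ 3 - C (18516) * X ^ 4 + C
      (3792899/64) * X ^ 5 - C (6461141/32) * X ^ 6 + C (2832065/4) * X ^ 7 - C (61104057/32) *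
      X ^ 8 + C (159472317/32) * X ^ 9 - C (3165096927/256) * X ^ 10 + C (7536475529/256) * X ^
      11 - C (8382622961/128) * X ^ 12 + C (454608305/4) * X ^ 13, Polynomial.funext fun t => ?_⟩
    simp only [branchPow, parabolaY_eval, eval_add, eval_sub, eval_neg, eval_mul, eval_pow, eval_X, eval_C, eval_one,
      eval_zero]
    ring
  · refine ⟨C (70) - C (230) * X + C (1363/4) * X ^ 2 - C (1541/2) * X ^ 3 + C (3997/2) * X ^ 4 - C
      (6042) * X ^ 5 + C (80345/4) * X ^ 6 - C (4366199/64) * X ^ 7 + C (15058633/64) * X ^ 8 -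
      C (3300753/4) * X ^ 9 + C (74579545/32) * X ^ 10 - C (382733467/64) * X ^ 11 + C
      (852643801/64) * X ^ 12 - C (711328289/32) * X ^ 13, Polynomial.funext fun t => ?_⟩
    simp only [branchPow, parabolaY_eval, eval_add, eval_sub, eval_neg, eval_mul, eval_pow, eval_X, eval_C, eval_one,
      eval_zero]
    ring

/-- `y ^ j` modulo `t ^ 6` on the parabola `v = u²`. -/
noncomputable def parabolaPow : ℕ → ℂ[X]
  | 0 => 1
  | 1 =>
    X ^ 3 - C (2) * X ^ 4 + C (4) * X ^ 5
  | 2 =>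
    0
  | 3 =>
    0
  | 4 =>
    0
  | 5 =>
    0
  | _ => 0

set_option linter.unusedSimpArgs false in
lemma parabolaPow_succ (j : ℕ) (hj : j + 1 < 6) :
    X ^ 6 ∣ parabolaY (1) * parabolaPow j - parabolaPow (j + 1) := by
  have : j < 5 := by lia
  interval_cases j
  · refine ⟨-C (9) + C (111/4) * X - C (183/2) * X ^ 2 + C (316) * X ^ 3 - C (1079) * X ^ 4 + C
      (7259/2) * X ^ 5 - C (801559/64) * X ^ 6 + C (2872109/64) * X ^ 7 - C (5348333/32) * X ^ 8, Polynomial.funext fun t => ?_⟩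
    simp only [parabolaPow, parabolaY_eval, eval_add, eval_sub, eval_neg, eval_mul, eval_pow, eval_X, eval_C, eval_one,
      eval_zero]
    ring
  · refine ⟨1 - C (4) * X + C (12) * X ^ 2 - C (25) * X ^ 3 + C (247/4) * X ^ 4 - C (183) * X ^ 5 + C
      (610) * X ^ 6 - C (2077) * X ^ 7 + C (14103/2) * X ^ 8 - C (1542359/64) * X ^ 9 + C
      (5404379/64) * X ^ 10 - C (1227945/4) * X ^ 11 + C (4110221/8) * X ^ 12 - C (5348333/8) *
      X ^ 13, Polynomial.funext fun t => ?_⟩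
    simp only [parabolaPow, parabolaY_eval, eval_add, eval_sub, eval_neg, eval_mul, eval_pow, eval_X, eval_C, eval_one,
      eval_zero]
    ring
  · refine ⟨0, Polynomial.funext fun t => ?_⟩
    simp only [parabolaPow, parabolaY_eval, eval_add, eval_sub, eval_neg, eval_mul, eval_pow, eval_X, eval_C, eval_one,
      eval_zero]
    ring
  · refine ⟨0, Polynomial.funext fun t => ?_⟩
    simp only [parabolaPow, parabolaY_eval, eval_add, eval_sub, eval_neg, eval_mul, eval_pow, eval_X, eval_C, eval_one,
      eval_zero]
    ring
  · refine ⟨0, Polynomial.funext fun t => ?_⟩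
    simp only [parabolaPow, parabolaY_eval, eval_add, eval_sub, eval_neg, eval_mul, eval_pow, eval_X, eval_C, eval_one,
      eval_zero]
    ring

/-- `y ^ j` modulo `t ^ 7` on the parabola `h₁ = 0`. -/
noncomputable def tangentPow : ℕ → ℂ[X]
  | 0 => 1
  | 1 =>
    -C (13/9) * X ^ 2 + X ^ 3 - C (2) * X ^ 4 + C (4) * X ^ 5 - C (9) * X ^ 6
  | 2 =>
    C (169/81) * X ^ 4 - C (26/9) * X ^ 5 + C (61/9) * X ^ 6
  | 3 =>
    -C (2197/729) * X ^ 6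
  | 4 =>
    0
  | 5 =>
    0
  | _ => 0

set_option linter.unusedSimpArgs false in
lemma tangentPow_succ (j : ℕ) (hj : j + 1 < 6) :
    X ^ 7 ∣ parabolaY (-4/9) * tangentPow j - tangentPow (j + 1) := by
  have : j < 5 := by lia
  interval_cases j
  · refine ⟨C (111/4) - C (183/2) * X + C (316) * X ^ 2 - C (1079) * X ^ 3 + C (7259/2) * X ^ 4 - C
      (801559/64) * X ^ 5 + C (2872109/64) * X ^ 6 - C (5348333/32) * X ^ 7, Polynomial.funext fun t => ?_⟩
    simp only [tangentPow, parabolaY_eval, eval_add, eval_sub, eval_neg, eval_mul, eval_pow, eval_X, eval_C, eval_one,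
      eval_zero]
    ring
  · refine ⟨-C (140/9) + C (38) * X - C (889/12) * X ^ 2 + C (2543/12) * X ^ 3 - C (6079/9) * X ^ 4 +
      C (20246/9) * X ^ 5 - C (272497/36) * X ^ 6 + C (14956267/576) * X ^ 7 - C (6607099/72) *
      X ^ 8 + C (193289605/576) * X ^ 9 - C (1358607/4) * X ^ 10 + C (40095799/64) * X ^ 11 - C
      (68635645/64) * X ^ 12 + C (48134997/32) * X ^ 13, Polynomial.funext fun t => ?_⟩
    simp only [tangentPow, parabolaY_eval, eval_add, eval_sub, eval_neg, eval_mul, eval_pow, eval_X, eval_C, eval_one,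
      eval_zero]
    ring
  · refine ⟨C (169/27) - C (455/27) * X + C (1693/81) * X ^ 2 - C (395/9) * X ^ 3 + C (11989/108) * X
      ^ 4 - C (8966/27) * X ^ 5 + C (360199/324) * X ^ 6 - C (613057/162) * X ^ 7 + C
      (2078711/162) * X ^ 8 - C (227730607/5184) * X ^ 9 + C (800477339/5184) * X ^ 10 - C
      (2919865951/5184) * X ^ 11 + C (453311965/576) * X ^ 12 - C (326248313/288) * X ^ 13, Polynomial.funext fun t => ?_⟩
    simp only [tangentPow, parabolaY_eval, eval_add, eval_sub, eval_neg, eval_mul, eval_pow, eval_X, eval_C, eval_one,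
      eval_zero]
    ring
  · refine ⟨C (28561/6561) * X - C (2197/729) * X ^ 2 + C (4394/729) * X ^ 3 - C (8788/729) * X ^ 4 +
      C (2197/81) * X ^ 5 - C (81289/972) * X ^ 6 + C (134017/486) * X ^ 7 - C (694252/729) * X
      ^ 8 + C (2370563/729) * X ^ 9 - C (15948023/1458) * X ^ 10 + C (1761025123/46656) * X ^ 11
      - C (6310023473/46656) * X ^ 12 + C (11750287601/23328) * X ^ 13, Polynomial.funext fun t => ?_⟩
    simp only [tangentPow, parabolaY_eval, eval_add, eval_sub, eval_neg, eval_mul, eval_pow, eval_X, eval_C, eval_one,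
      eval_zero]
    ring
  · refine ⟨0, Polynomial.funext fun t => ?_⟩
    simp only [tangentPow, parabolaY_eval, eval_add, eval_sub, eval_neg, eval_mul, eval_pow, eval_X, eval_C, eval_one,
      eval_zero]
    ring

end Polynomial

set_option maxHeartbeats 1600000 in
/-- Solving the linear system satisfied by the coefficients of `g`. -/
lemma exists_smul_of_sigma_mem {g : MvPolynomial (Fin 2) ℂ} (hg : g.totalDegree ≤ 5)
    (hσ : σ g ∈ J₈) : ∃ c : ℂ, g = c • (v ^ 3 * f₂) := by
  obtain ⟨a, ha⟩ := eq_sum_of_totalDegree_le hg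
  have hh {d : ℕ} (hd : d < 13) := Polynomial.sum_coeff_eq_zero le_rfl (.inl rfl) (.inl rfl)
    ha hσ rfl Polynomial.branchPow_succ hd
  have hk {d : ℕ} (hd : d < 6) := Polynomial.sum_coeff_eq_zero (by lia) (.inr (by lia))
    (.inr (.inr le_rfl)) ha hσ rfl Polynomial.parabolaPow_succ hd
  have hl {d : ℕ} (hd : d < 7) := Polynomial.sum_coeff_eq_zero (by lia) (.inr le_rfl)
    (.inr (.inl rfl)) ha hσ rfl Polynomial.tangentPow_succ hd
  simp only [Finset.sum_range_succ, Finset.sum_range_zero, zero_add, Nat.reduceAdd, Nat.reduceSub,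
    Polynomial.branchPow, Polynomial.parabolaPow, Polynomial.tangentPow] at hh hk hl
  have h0 := hh (d := 0) (by lia)
  have h1 := hh (d := 1) (by lia)
  have h2 := hh (d := 2) (by lia)
  have h3 := hh (d := 3) (by lia)
  have h4 := hh (d := 4) (by lia)
  have h5 := hh (d := 5) (by lia)
  have h6 := hh (d := 6) (by lia)
  have h7 := hh (d := 7) (by lia)
  have h8 := hh (d := 8) (by lia)
  have h9 := hh (d := 9) (by lia)
  have h10 := hh (d := 10) (by lia)
  have h11 := hh (d := 11) (by lia)
  have h12 := hh (d := 12) (by lia)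
  have k2 := hk (d := 2) (by lia)
  have k3 := hk (d := 3) (by lia)
  have k4 := hk (d := 4) (by lia)
  have k5 := hk (d := 5) (by lia)
  have l4 := hl (d := 4) (by lia)
  have l5 := hl (d := 5) (by lia)
  have l6 := hl (d := 6) (by lia)
  simp [Polynomial.coeff_X_pow_mul', Polynomial.coeff_X, Polynomial.coeff_one,
    Polynomial.coeff_C] at h0 h1 h2 h3 h4 h5 h6 h7 h8 h9 h10 h11 h12 k2 k3 k4 k5 l4 l5 l6
  have a00 : a 0 0 = 0 := by
    linear_combination
      h0
  have a01 : a 0 1 = 0 := by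
    linear_combination
      -h2 + k2
  have a02 : a 0 2 = 0 := by
    linear_combination
      -9/4 * h4 + 9/13 * k4 + 81/52 * l4
  have a03 : a 0 3 = 0 := by
    linear_combination
      -1593/26 * h2 + 513/26 * h3 + 225/13 * h4 - 81/16 * h5 + 45/16 * h6 + 4/3 * h7 + 2/3 * h8
      - 2 * h9 - 5/3 * h10 - 1/3 * h11 + 1593/26 * k2 - 513/26 * k3 - 9/169 * k4 + 81/169 * k5 -
      2916/169 * l4 + 12393/2704 * l5 - 729/208 * l6
  have a04 : a 0 4 = a 0 5 := by
    linear_combination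
      -5129/26 * h2 + 3483/52 * h3 + 3789/104 * h4 - 27/2 * h5 + 29/16 * h6 - 2/3 * h7 + 11/3 *
      h8 + 2 * h9 - 2/3 * h10 - 1/3 * h11 + 5129/26 * k2 - 3483/52 * k3 + 576/169 * k4 - 270/169
      * k5 - 53865/1352 * l4 + 5103/338 * l5 - 729/208 * l6
  have a10 : a 1 0 = 0 := by
    linear_combination
      h1
  have a11 : a 1 1 = 0 := by
    linear_combination
      -h3 + k3
  have a12 : a 1 2 = 0 := by
    linear_combination
      -9/4 * h5 + 9/13 * k5 + 81/52 * l5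
  have a13 : a 1 3 = 0 := by
    linear_combination
      -41673/208 * h2 + 552/13 * h3 + 1251/26 * h4 - 117/8 * h5 + 1679/216 * h6 + 118/27 * h7 -
      4 * h9 - 50/27 * h10 + 2/9 * h11 + 4/27 * h12 + 41673/208 * k2 - 552/13 * k3 - 720/169 *
      k4 + 396/169 * k5 - 14823/338 * l4 + 16605/1352 * l5 - 729/104 * l6
  have a14 : a 1 4 = a 0 5 := by
    linear_combination
      -40941/208 * h2 + 1267/26 * h3 + 7227/208 * h4 - 63/4 * h5 + 1279/432 * h6 + 55/27 * h7 +
      16/3 * h8 + 3 * h9 + 22/27 * h10 + 5/9 * h11 + 4/27 * h12 + 40941/208 * k2 - 1267/26 * k3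
      - 126/169 * k4 - 153/169 * k5 - 91935/2704 * l4 + 11259/676 * l5 - 729/208 * l6
  have a20 : a 2 0 = 0 := by
    linear_combination
      k2
  have a21 : a 2 1 = 0 := by
    linear_combination
      -13/4 * h4 + 22/13 * k4 + 81/52 * l4
  have a22 : a 2 2 = 0 := by
    linear_combination
      -1866/13 * h2 + 591/13 * h3 + 2515/52 * h4 - 117/8 * h5 + 37/8 * h6 + 88/27 * h7 + 44/27 *
      h8 - 44/9 * h9 - 110/27 * h10 - 22/27 * h11 + 1866/13 * k2 - 591/13 * k3 - 499/169 * k4 +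
      396/169 * k5 - 30699/676 * l4 + 16605/1352 * l5 - 729/104 * l6
  have a23 : a 2 3 = a 0 5 := by
    linear_combination
      -66841/208 * h2 + 2235/26 * h3 + 7357/104 * h4 - 369/16 * h5 + 1247/216 * h6 + 26/27 * h7
      + 62/27 * h8 - 8/9 * h9 - 43/27 * h10 + 2/27 * h11 + 4/27 * h12 + 66841/208 * k2 - 2235/26
      * k3 - 200/169 * k4 + 45/169 * k5 - 94041/1352 * l4 + 61641/2704 * l5 - 729/104 * l6
  have a30 : a 3 0 = 0 := by
    linear_combination
      h2 - k2 + k3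
  have a31 : a 3 1 = 0 := by
    linear_combination
      9/2 * h4 - 13/4 * h5 - 18/13 * k4 + 22/13 * k5 - 81/26 * l4 + 81/52 * l5
  have a32 : a 3 2 = 0 := by
    linear_combination
      -42141/208 * h2 + 565/13 * h3 + 1485/26 * h4 - 125/8 * h5 + 1679/216 * h6 + 161/27 * h7 +
      8/27 * h8 - 44/9 * h9 - 70/27 * h10 + 2/27 * h11 + 4/27 * h12 + 42141/208 * k2 - 565/13 *
      k3 - 1188/169 * k4 + 565/169 * k5 - 16929/338 * l4 + 16605/1352 * l5 - 729/104 * l6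
  have a40 : a 4 0 = 0 := by
    linear_combination
      -2 * h2 + h3 + 2 * k2 - k3 + k4
  have a41 : a 4 1 = 0 := by
    linear_combination
      -1905/26 * h2 + 565/26 * h3 + 801/26 * h4 - 133/16 * h5 + 13/16 * h6 + 52/27 * h7 + 26/27
      * h8 - 26/9 * h9 - 65/27 * h10 - 13/27 * h11 + 1905/26 * k2 - 565/26 * k3 - 711/169 * k4 +
      367/169 * k5 - 8991/338 * l4 + 16605/2704 * l5 - 729/208 * l6
  have a50 : a 5 0 = 0 := by
    linear_combination
      4 * h2 - 2 * h3 + 13/4 * h4 - 4 * k2 + 2 * k3 - 22/13 * k4 + k5 - 81/52 * l4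
  refine ⟨a 0 5, ?_⟩
  rw [ha, smul_eq_C_mul, f₂]
  simp only [Finset.sum_range_succ, Finset.sum_range_zero, zero_add, Nat.reduceAdd, Nat.reduceSub,
    a00, a01, a02, a03, a04, a10, a11, a12, a13, a14, a20, a21, a22, a23, a30, a31, a32,
    a40, a41, a50, C_0]
  ring

/-- Case `k = 8` of Assertion 3(b): `Ker σ̄₈` is the one-dimensional space `ℂ·y³f₂`. -/
theorem ker_sigma_eight :
    {g : MvPolynomial (Fin 2) ℂ | g.totalDegree ≤ 5 ∧ σ g ∈ J₈} =
      ↑(Submodule.span ℂ {v ^ 3 * f₂}) ∧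
    Module.finrank ℂ ↥(Submodule.span ℂ ({v ^ 3 * f₂} :
      Set (MvPolynomial (Fin 2) ℂ))) = 1 := by
  refine ⟨Set.ext fun g => ?_, finrank_span_singleton ?_⟩
  · rw [SetLike.mem_coe, Submodule.mem_span_singleton]
    constructor
    · rintro ⟨hg, hσ⟩
      obtain ⟨c, rfl⟩ := exists_smul_of_sigma_mem hg hσ
      exact ⟨c, rfl⟩
    · rintro ⟨c, rfl⟩
      refine ⟨(totalDegree_smul_le _ _).trans totalDegree_v_cubed_mul_conic_le, ?_⟩
      rw [σ, map_smul, smul_eq_C_mul]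
      exact J₈.mul_mem_left _ sigma_v_cubed_mul_conic_mem
  · intro h
    have := congrArg (eval ![0, 1]) h
    simp [u, v, f₂] at this
end
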